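/- arXiv:1909.07947 — 8 statements merged into one kernel-verified Lean document; each statement's English description precedes it below -/
import Mathlib

section
/- Let C ∈ ℝ^{p₁×p₂} with columns c₁,…,c_{p₂}, let z₁ ∈ ℝ^{p₁} be fixed, and let γ₂ ≥ 0. Then the supremum over z₂ in the closed unit ball B^{p₂} of the penalized objective z₁ᵀ C z₂ − γ₂‖z₂‖₁ equals sqrt( Σ_{i=1}^{p₂} ([|cᵢᵀ z₁| − γ₂]₊)² ). -/
open Finset Metric

theorem aux_greatest (p : ℕ) (a : Fin p → ℝ) (γ : ℝ) (hγ : 0 ≤ γ) :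
    IsGreatest ((fun z : EuclideanSpace ℝ (Fin p) =>
        (∑ i, a i * z i) - γ * ∑ i, |z i|) '' closedBall 0 1)
      (Real.sqrt (∑ i, (max (|a i| - γ) 0) ^ 2)) := by
  have hS : 0 ≤ ∑ i, (max (|a i| - γ) 0) ^ 2 := Finset.sum_nonneg fun i _ => sq_nonneg _
  constructor
  · set S := ∑ i, (max (|a i| - γ) 0) ^ 2 with hSdef
    refine ⟨WithLp.toLp 2 fun i => (if 0 ≤ a i then 1 else -1) * (max (|a i| - γ) 0 / √S), ?_, ?_⟩
    · rw [mem_closedBall_zero_iff, EuclideanSpace.norm_eq, Real.sqrt_le_one]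
      have : ∀ i, ‖(if 0 ≤ a i then (1:ℝ) else -1) * (max (|a i| - γ) 0 / √S)‖ ^ 2
          = (max (|a i| - γ) 0) ^ 2 / S := by
        intro i
        rw [Real.norm_eq_abs, sq_abs, mul_pow, div_pow, Real.sq_sqrt hS]
        split_ifs <;> norm_num
      simp only [this]
      rw [← Finset.sum_div, ← hSdef]
      exact div_self_le_one S
    · have h : ∀ i, a i * ((if 0 ≤ a i then (1:ℝ) else -1) * (max (|a i| - γ) 0 / √S))
          - γ * |(if 0 ≤ a i then (1:ℝ) else -1) * (max (|a i| - γ) 0 / √S)|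
          = (max (|a i| - γ) 0) ^ 2 / √S := by
        intro i
        have h1 : |(if 0 ≤ a i then (1:ℝ) else -1)| = 1 := by split_ifs <;> norm_num
        have h2 : a i * (if 0 ≤ a i then (1:ℝ) else -1) = |a i| := by
          split_ifs with h
          · rw [abs_of_nonneg h, mul_one]
          · rw [abs_of_neg (not_le.mp h)]; ring
        have h3 : 0 ≤ max (|a i| - γ) 0 / √S := by positivity
        have h4 : (|a i| - γ) * max (|a i| - γ) 0 = (max (|a i| - γ) 0) ^ 2 := by
          rcases max_cases (|a i| - γ) 0 with h | h <;> rw [h.1] <;> ring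
        rw [abs_mul, h1, abs_of_nonneg h3, ← mul_assoc, h2, ← h4]
        ring
      simp only [Finset.mul_sum]
      rw [← Finset.sum_sub_distrib]
      simp only [h]
      rw [← Finset.sum_div, ← hSdef, Real.div_sqrt]
  · rintro _ ⟨z, hz, rfl⟩
    rw [mem_closedBall_zero_iff, EuclideanSpace.norm_eq] at hz
    simp only [Real.norm_eq_abs] at hz
    have h1 : (∑ i, a i * z i) - γ * ∑ i, |z i| ≤ ∑ i, max (|a i| - γ) 0 * |z i| := by
      rw [Finset.mul_sum, ← Finset.sum_sub_distrib]
      refine Finset.sum_le_sum fun i _ => ?_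
      have h2 := le_abs_self (a i * z i)
      rw [abs_mul] at h2
      have h3 := mul_le_mul_of_nonneg_right (le_max_left (|a i| - γ) 0) (abs_nonneg (z i))
      linarith
    have h4 := Real.sum_mul_le_sqrt_mul_sqrt Finset.univ (fun i => max (|a i| - γ) 0) (fun i => |z i|)
    have h5 := mul_le_mul_of_nonneg_left hz (Real.sqrt_nonneg (∑ i, (max (|a i| - γ) 0) ^ 2))
    simp only at *
    linarith

/-- For fixed `z₁` and `γ₂ ≥ 0`, the supremum over `z₂` in the closed
unit ball of `z₁ᵀ C z₂ - γ₂‖z₂‖₁` equals `√(∑ i, ([|cᵢᵀ z₁| - γ₂]₊)²)`. -/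
theorem stmt_0 (p₁ p₂ : ℕ) (C : Matrix (Fin p₁) (Fin p₂) ℝ)
    (z₁ : EuclideanSpace ℝ (Fin p₁)) (γ₂ : ℝ) (hγ₂ : 0 ≤ γ₂) :
    sSup ((fun z₂ : EuclideanSpace ℝ (Fin p₂) =>
        (∑ i, (∑ j, z₁ j * C j i) * z₂ i) - γ₂ * ∑ i, |z₂ i|) '' closedBall 0 1) =
      Real.sqrt (∑ i, (max (|∑ j, C j i * z₁ j| - γ₂) 0) ^ 2) := by
  have hc : ∀ i, (∑ j, z₁ j * C j i) = ∑ j, C j i * z₁ j := fun i =>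
    Finset.sum_congr rfl fun j _ => mul_comm _ _
  simp only [hc]
  apply IsGreatest.csSup_eq
  exact aux_greatest p₂ (fun i => ∑ j, C j i * z₁ j) γ₂ hγ₂
end

section
/- Let C ∈ ℝ^{p₁×p₂} with columns c₁,…,c_{p₂}, let z₁ ∈ ℝ^{p₁} be fixed, let γ₂ ≥ 0, and suppose S := Σ_{k=1}^{p₂} ([|c_kᵀ z₁| − γ₂]₊)² > 0. Then the vector z₂* ∈ ℝ^{p₂} with entries z₂ᵢ* = sgn(cᵢᵀ z₁)·[|cᵢᵀ z₁| − γ₂]₊ / √S has ‖z₂*‖₂ = 1 and attains the supremum of z₂ ↦ z₁ᵀ C z₂ − γ₂‖z₂‖₁ over the closed unit ball B^{p₂}, with optimal value √S. -/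
open Finset Metric

theorem aux_abs (a g : ℝ) (hg : 0 ≤ g) :
    |Real.sign a * max (|a| - g) 0| = max (|a| - g) 0 := by
  have hm : 0 ≤ max (|a| - g) 0 := le_max_right _ _
  rcases lt_trichotomy a 0 with h | h | h
  · rw [Real.sign_of_neg h, neg_one_mul, abs_neg, abs_of_nonneg hm]
  · subst h
    simp [hg]
  · rw [Real.sign_of_pos h, one_mul, abs_of_nonneg hm]

theorem aux_mul (a g : ℝ) :
    a * (Real.sign a * max (|a| - g) 0) - g * max (|a| - g) 0 = (max (|a| - g) 0) ^ 2 := by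
  have h1 : a * Real.sign a = |a| := by
    rcases lt_trichotomy a 0 with h | h | h
    · rw [Real.sign_of_neg h, abs_of_neg h]; ring
    · subst h
      simp
    · rw [Real.sign_of_pos h, abs_of_pos h]; ring
  rw [← mul_assoc, h1]
  rcases le_total (|a| - g) 0 with h | h
  · rw [max_eq_right h]; ring
  · rw [max_eq_left h]; ring

/-- with `S = ∑ k ([|c_kᵀ z₁| - γ₂]₊)² > 0`, the soft-thresholded vector
`z₂*` with entries `sgn(cᵢᵀ z₁)[|cᵢᵀ z₁| - γ₂]₊/√S` has unit norm and attains the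
supremum of the `ℓ₁`-penalized objective over the closed unit ball, with value `√S`. -/
theorem stmt_1 (p₁ p₂ : ℕ) (C : Matrix (Fin p₁) (Fin p₂) ℝ)
    (z₁ : EuclideanSpace ℝ (Fin p₁)) (γ₂ : ℝ) (hγ₂ : 0 ≤ γ₂)
    (S : ℝ) (hS : S = ∑ k, (max (|∑ j, C j k * z₁ j| - γ₂) 0) ^ 2) (hSpos : 0 < S)
    (z₂star : EuclideanSpace ℝ (Fin p₂))
    (hz : ∀ i, z₂star i =
      Real.sign (∑ j, C j i * z₁ j) * max (|∑ j, C j i * z₁ j| - γ₂) 0 / Real.sqrt S) :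
    ‖z₂star‖ = 1 ∧
    ((∑ i, (∑ j, z₁ j * C j i) * z₂star i) - γ₂ * ∑ i, |z₂star i| = Real.sqrt S) ∧
    ∀ z₂ : EuclideanSpace ℝ (Fin p₂), ‖z₂‖ ≤ 1 →
      (∑ i, (∑ j, z₁ j * C j i) * z₂ i) - γ₂ * ∑ i, |z₂ i| ≤ Real.sqrt S := by
  have hsym : ∀ i, ∑ j, z₁ j * C j i = ∑ j, C j i * z₁ j :=
    fun i => Finset.sum_congr rfl fun j _ => mul_comm _ _
  simp only [hsym]
  obtain ⟨a, ha⟩ : ∃ a : Fin p₂ → ℝ, ∀ i, ∑ j, C j i * z₁ j = a i := ⟨_, fun _ => rfl⟩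
  simp only [ha] at *
  have hr : 0 < Real.sqrt S := Real.sqrt_pos.2 hSpos
  have hrr : Real.sqrt S ^ 2 = S := Real.sq_sqrt hSpos.le
  have habs : ∀ i, |z₂star i| = max (|a i| - γ₂) 0 / Real.sqrt S := fun i => by
    rw [hz, abs_div, aux_abs _ _ hγ₂, abs_of_pos hr]
  refine ⟨?_, ?_, ?_⟩
  · rw [EuclideanSpace.norm_eq]
    simp only [Real.norm_eq_abs, habs, div_pow]
    rw [← Finset.sum_div, ← hS, hrr, div_self hSpos.ne', Real.sqrt_one]
  · rw [Finset.mul_sum, ← Finset.sum_sub_distrib]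
    have : ∀ i, a i * z₂star i - γ₂ * |z₂star i| = (max (|a i| - γ₂) 0) ^ 2 / Real.sqrt S := by
      intro i
      rw [habs, hz, ← aux_mul]; ring
    simp only [this]
    rw [← Finset.sum_div, ← hS, Real.div_sqrt]
  · intro z hzn
    rw [Finset.mul_sum, ← Finset.sum_sub_distrib]
    rw [EuclideanSpace.norm_eq] at hzn
    simp only [Real.norm_eq_abs] at hzn
    calc ∑ i, (a i * z i - γ₂ * |z i|) ≤ ∑ i, max (|a i| - γ₂) 0 * |z i| := by
          refine Finset.sum_le_sum fun i _ => ?_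
          have h1 : a i * z i ≤ |a i| * |z i| := by rw [← abs_mul]; exact le_abs_self _
          have h2 := mul_le_mul_of_nonneg_right (le_max_left (|a i| - γ₂) 0) (abs_nonneg (z i))
          linarith
      _ ≤ Real.sqrt (∑ i, max (|a i| - γ₂) 0 ^ 2) * Real.sqrt (∑ i, |z i| ^ 2) :=
          Real.sum_mul_le_sqrt_mul_sqrt _ _ _
      _ ≤ Real.sqrt S := by
          rw [← hS]
          exact mul_le_of_le_one_right hr.le hzn
end

section
/- Let C ∈ ℝ^{p₁×p₂} with columns c₁,…,c_{p₂}, let z₁ ∈ ℝ^{p₁} be fixed, and let γ₂ ≥ 0. Then the supremum over z₂ in the closed unit ball B^{p₂} of the cardinality-penalized objective (z₁ᵀ C z₂)² − γ₂‖z₂‖₀ equals Σ_{i=1}^{p₂} [(cᵢᵀ z₁)² − γ₂]₊. -/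
open Finset Metric

/-- for fixed `z₁` and `γ₂ ≥ 0`, the supremum over `z₂` in the closed unit
ball of the cardinality-penalized objective `(z₁ᵀ C z₂)² - γ₂‖z₂‖₀` equals
`∑ i, [(cᵢᵀ z₁)² - γ₂]₊`. -/
theorem stmt_4 (p₁ p₂ : ℕ) (C : Matrix (Fin p₁) (Fin p₂) ℝ)
    (z₁ : EuclideanSpace ℝ (Fin p₁)) (γ₂ : ℝ) (hγ₂ : 0 ≤ γ₂) :
    sSup ((fun z₂ : EuclideanSpace ℝ (Fin p₂) =>
        (∑ i, (∑ j, z₁ j * C j i) * z₂ i) ^ 2 -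
          γ₂ * ((Finset.univ.filter fun i => z₂ i ≠ 0).card : ℝ)) '' closedBall 0 1) =
      ∑ i, max ((∑ j, C j i * z₁ j) ^ 2 - γ₂) 0 := by
  have hcomm : ∀ i, (∑ j, C j i * z₁ j) = ∑ j, z₁ j * C j i := fun i =>
    Finset.sum_congr rfl fun j _ => mul_comm _ _
  simp only [hcomm]
  obtain ⟨a, ha⟩ : ∃ a : Fin p₂ → ℝ, ∀ i, (∑ j, z₁ j * C j i) = a i := ⟨_, fun _ => rfl⟩
  simp only [ha]
  have hball : ∀ z : EuclideanSpace ℝ (Fin p₂), z ∈ closedBall 0 1 ↔ ∑ i, z i ^ 2 ≤ 1 := by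
    intro z
    rw [mem_closedBall_zero_iff, ← EuclideanSpace.real_norm_sq_eq, sq_le_one_iff₀ (norm_nonneg _)]
  have hconst : ∀ T : Finset (Fin p₂), ∑ i ∈ T, a i ^ 2 - γ₂ * (T.card : ℝ)
      = ∑ i ∈ T, (a i ^ 2 - γ₂) := by
    intro T
    rw [Finset.sum_sub_distrib, Finset.sum_const, nsmul_eq_mul, mul_comm]
  apply IsGreatest.csSup_eq
  constructor
  · set S : Finset (Fin p₂) := Finset.univ.filter fun i => γ₂ < a i ^ 2 with hS
    set Q : ℝ := ∑ i ∈ S, a i ^ 2 with hQ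
    have hQ0 : 0 ≤ Q := Finset.sum_nonneg fun i _ => sq_nonneg _
    have hmax : ∑ i, max (a i ^ 2 - γ₂) 0 = ∑ i ∈ S, (a i ^ 2 - γ₂) := by
      rw [hS, Finset.sum_filter]
      refine Finset.sum_congr rfl fun i _ => ?_
      split_ifs with h
      · exact max_eq_left (by linarith)
      · exact max_eq_right (by linarith)
    have hpos : ∀ i ∈ S, 0 < a i ^ 2 := fun i hi => lt_of_le_of_lt hγ₂ (by simpa [hS] using hi)
    have hQi : ∀ i ∈ S, Q ≠ 0 := fun i hi =>
      (lt_of_lt_of_le (hpos i hi)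
        (Finset.single_le_sum (f := fun i => a i ^ 2) (fun i _ => sq_nonneg _) hi)).ne'
    have hsq : √Q ^ 2 = Q := Real.sq_sqrt hQ0
    have hz1 : ∀ k : Fin p₂ → ℝ, ∑ i, (if i ∈ S then k i else 0) = ∑ i ∈ S, k i := by
      intro k; simp
    refine ⟨WithLp.toLp 2 fun i => if i ∈ S then a i / √Q else 0, ?_, ?_⟩
    · rw [hball]
      have : ∀ i, (if i ∈ S then a i / √Q else 0) ^ 2 = if i ∈ S then a i ^ 2 / Q else 0 := by
        intro i; split_ifs
        · rw [div_pow, hsq]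
        · simp
      simp only [this, hz1]
      rw [← Finset.sum_div]
      exact div_self_le_one Q
    · have hc : (Finset.univ.filter fun i => (if i ∈ S then a i / √Q else 0) ≠ 0) = S := by
        ext i
        simp only [Finset.mem_filter, Finset.mem_univ, true_and]
        by_cases h : i ∈ S
        · simp only [h, if_true, iff_true]
          refine div_ne_zero (fun h0 => ?_) (fun h0 => ?_)
          · have := hpos i h
            rw [h0] at this; norm_num at this
          · exact hQi i h (by rw [← hsq, h0]; norm_num)
        · simp [h]
      have hv : (∑ i, a i * (if i ∈ S then a i / √Q else 0)) = √Q := by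
        simp only [mul_ite, mul_zero, hz1]
        have : ∀ i, a i * (a i / √Q) = a i ^ 2 / √Q := fun i => by ring
        simp only [this]
        rw [← Finset.sum_div]
        exact Real.div_sqrt
      simp only [hc, hv]
      rw [hsq, hmax, ← hconst]
  · rintro _ ⟨z, hz, rfl⟩
    rw [hball] at hz
    set T : Finset (Fin p₂) := Finset.univ.filter fun i => z i ≠ 0 with hT
    have h1 : ∑ i, a i * z i = ∑ i ∈ T, a i * z i := by
      symm
      apply Finset.sum_subset (Finset.subset_univ _)
      intro i _ hi
      have : z i = 0 := by simpa [hT] using hi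
      rw [this, mul_zero]
    have h2 := Finset.sum_mul_sq_le_sq_mul_sq T a z
    have h3 : ∑ i ∈ T, z i ^ 2 ≤ 1 := le_trans
      (Finset.sum_le_sum_of_subset_of_nonneg (Finset.subset_univ _) fun i _ _ => sq_nonneg _) hz
    have h4 : 0 ≤ ∑ i ∈ T, a i ^ 2 := Finset.sum_nonneg fun i _ => sq_nonneg _
    have h5 : ∑ i ∈ T, (a i ^ 2 - γ₂) ≤ ∑ i ∈ T, max (a i ^ 2 - γ₂) 0 :=
      Finset.sum_le_sum fun i _ => le_max_left _ _
    have h6 : ∑ i ∈ T, max (a i ^ 2 - γ₂) 0 ≤ ∑ i, max (a i ^ 2 - γ₂) 0 :=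
      Finset.sum_le_sum_of_subset_of_nonneg (Finset.subset_univ _) fun i _ _ => le_max_right _ _
    have h7 := hconst T
    have h8 := mul_le_mul_of_nonneg_left h3 h4
    show (∑ i, a i * z i) ^ 2 - γ₂ * (T.card : ℝ) ≤ _
    rw [h1]
    linarith
end

section
/- Let C ∈ ℝ^{p₁×p₂} with columns c₁,…,c_{p₂}, let z₁ ∈ ℝ^{p₁}, γ₂ ≥ 0, and suppose D := Σ_{k=1}^{p₂} [sgn((c_kᵀ z₁)² − γ₂)]₊ · (c_kᵀ z₁)² > 0. Then the vector z₂* ∈ ℝ^{p₂} with entries z₂ᵢ* = [sgn((cᵢᵀ z₁)² − γ₂)]₊ · (cᵢᵀ z₁) / √D has ‖z₂*‖₂ = 1 and attains the supremum of z₂ ↦ (z₁ᵀ C z₂)² − γ₂‖z₂‖₀ over the closed unit ball B^{p₂}. -/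
open Finset Metric

/-- with `D = ∑ k [sgn((c_kᵀ z₁)² - γ₂)]₊ (c_kᵀ z₁)² > 0`, the vector `z₂*`
with entries `[sgn((cᵢᵀ z₁)² - γ₂)]₊ (cᵢᵀ z₁)/√D` has unit norm and attains the supremum
of the cardinality-penalized objective over the closed unit ball. -/
theorem stmt_5 (p₁ p₂ : ℕ) (C : Matrix (Fin p₁) (Fin p₂) ℝ)
    (z₁ : EuclideanSpace ℝ (Fin p₁)) (γ₂ : ℝ) (hγ₂ : 0 ≤ γ₂)
    (D : ℝ)
    (hD : D = ∑ k, max (Real.sign ((∑ j, C j k * z₁ j) ^ 2 - γ₂)) 0 * (∑ j, C j k * z₁ j) ^ 2)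
    (hDpos : 0 < D)
    (z₂star : EuclideanSpace ℝ (Fin p₂))
    (hz : ∀ i, z₂star i =
      max (Real.sign ((∑ j, C j i * z₁ j) ^ 2 - γ₂)) 0 * (∑ j, C j i * z₁ j) / Real.sqrt D) :
    ‖z₂star‖ = 1 ∧
    ∀ z₂ : EuclideanSpace ℝ (Fin p₂), ‖z₂‖ ≤ 1 →
      (∑ i, (∑ j, z₁ j * C j i) * z₂ i) ^ 2 -
          γ₂ * ((Finset.univ.filter fun i => z₂ i ≠ 0).card : ℝ) ≤
        (∑ i, (∑ j, z₁ j * C j i) * z₂star i) ^ 2 -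
          γ₂ * ((Finset.univ.filter fun i => z₂star i ≠ 0).card : ℝ) := by
  have hcomm : ∀ i, (∑ j, z₁ j * C j i) = ∑ j, C j i * z₁ j := fun i =>
    Finset.sum_congr rfl fun j _ => mul_comm _ _
  simp only [hcomm]
  obtain ⟨a, ha⟩ : ∃ a : Fin p₂ → ℝ, ∀ i, a i = ∑ j, C j i * z₁ j := ⟨_, fun _ => rfl⟩
  simp only [← ha] at hD hz ⊢
  obtain ⟨s, hs⟩ : ∃ s : Fin p₂ → ℝ, ∀ i, s i = max (Real.sign (a i ^ 2 - γ₂)) 0 :=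
    ⟨_, fun _ => rfl⟩
  simp only [← hs] at hD hz
  have hcase : ∀ i, (s i = 1 ∧ γ₂ < a i ^ 2) ∨ (s i = 0 ∧ a i ^ 2 ≤ γ₂) := by
    intro i
    rw [hs]
    rcases lt_trichotomy (a i ^ 2 - γ₂) 0 with h | h | h
    · right; rw [Real.sign_of_neg h]; constructor
      · norm_num
      · linarith
    · right; rw [h]; constructor
      · simp
      · linarith
    · left; rw [Real.sign_of_pos h]; constructor
      · norm_num
      · linarith
  have hsD : 0 < Real.sqrt D := Real.sqrt_pos.2 hDpos
  have hsq : Real.sqrt D ^ 2 = D := Real.sq_sqrt hDpos.le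
  have hss : ∀ i, s i ^ 2 = s i := by
    intro i; rcases hcase i with h | h <;> rw [h.1] <;> norm_num
  have hval : (∑ i, a i * z₂star i) = D / Real.sqrt D := by
    rw [hD, Finset.sum_div, ← hD]
    refine Finset.sum_congr rfl fun i _ => ?_
    rw [hz]; ring
  have hcard : ((Finset.univ.filter fun i => z₂star i ≠ 0).card : ℝ) = ∑ i, s i := by
    rw [Finset.card_filter]
    push_cast
    refine Finset.sum_congr rfl fun i _ => ?_
    rcases hcase i with h | h
    · have hane : a i ≠ 0 := by
        intro h0
        have := h.2
        rw [h0] at this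
        norm_num at this
        linarith
      rw [if_pos, h.1]
      rw [hz, h.1]
      exact div_ne_zero (by simpa using hane) hsD.ne'
    · rw [if_neg, h.1]
      rw [hz, h.1]; simp
  constructor
  · have h2 : ‖z₂star‖ ^ 2 = 1 := by
      rw [EuclideanSpace.real_norm_sq_eq]
      have : ∀ i, z₂star i ^ 2 = s i * a i ^ 2 / D := by
        intro i; rw [hz, div_pow, hsq, mul_pow, hss]
      simp only [this]
      rw [← Finset.sum_div, ← hD, div_self hDpos.ne']
    nlinarith [norm_nonneg z₂star]
  · intro z hzn
    have hz1 : ∑ i, z i ^ 2 ≤ 1 := by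
      rw [← EuclideanSpace.real_norm_sq_eq]
      nlinarith [norm_nonneg z]
    rw [hval, hcard, div_pow, hsq]
    have hDD : D ^ 2 / D = D := by field_simp
    rw [hDD]
    set S := Finset.univ.filter fun i => z i ≠ 0 with hS
    have e1 : (∑ i, a i * z i) = ∑ i ∈ S, a i * z i := by
      symm
      apply Finset.sum_subset (Finset.subset_univ _)
      intro i _ hi
      have : z i = 0 := by simpa [hS] using hi
      rw [this, mul_zero]
    have e2 := Finset.sum_mul_sq_le_sq_mul_sq S a (fun i => z i)
    have e3 : ∑ i ∈ S, z i ^ 2 ≤ 1 :=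
      (Finset.sum_le_sum_of_subset_of_nonneg (Finset.subset_univ _)
        fun i _ _ => sq_nonneg _).trans hz1
    have e4 : 0 ≤ ∑ i ∈ S, a i ^ 2 := Finset.sum_nonneg fun i _ => sq_nonneg _
    have e5 : (∑ i, a i * z i) ^ 2 ≤ ∑ i ∈ S, a i ^ 2 := by
      rw [e1]; exact e2.trans (mul_le_of_le_one_right e4 e3)
    have e6 : ∑ i ∈ S, (a i ^ 2 - γ₂) ≤ ∑ i, s i * (a i ^ 2 - γ₂) := by
      refine (Finset.sum_le_sum (g := fun i => s i * (a i ^ 2 - γ₂)) fun i _ => ?_).trans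
        (Finset.sum_le_sum_of_subset_of_nonneg (Finset.subset_univ _) fun i _ _ => ?_)
      · rcases hcase i with h | h <;> simp only [h.1] <;> linarith [h.2]
      · rcases hcase i with h | h <;> simp only [h.1] <;> linarith [h.2]
    have e7 : ∑ i, s i * (a i ^ 2 - γ₂) = D - γ₂ * ∑ i, s i := by
      rw [hD, Finset.mul_sum, ← Finset.sum_sub_distrib]
      exact Finset.sum_congr rfl fun i _ => by ring
    have e8 : ∑ i ∈ S, (a i ^ 2 - γ₂) = ∑ i ∈ S, a i ^ 2 - γ₂ * (S.card : ℝ) := by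
      rw [Finset.sum_sub_distrib, Finset.sum_const, nsmul_eq_mul, mul_comm γ₂]
    linarith
end

section
/- Let m ≥ 2, fix s ∈ {1,…,m}, and for each r ≠ s let C̃_{rs} ∈ ℝ^{p_r × p_s} with i-th column c̃_{rsi} ∈ ℝ^{p_r}, let z_r ∈ ℝ^{p_r} be fixed vectors, and let Γ_{sr} ≥ 0. Set aᵢ := Σ_{r≠s} c̃_{rsi}ᵀ z_r and γ := Σ_{r≠s} Γ_{sr}, and suppose S := Σ_{k=1}^{p_s} ([|a_k| − γ]₊)² > 0. Then the vector z_s* with entries z_{si}* = sgn(aᵢ)·[|aᵢ| − γ]₊ / √S has ‖z_s*‖₂ = 1 and attains the supremum of z_s ↦ Σ_{r≠s} z_rᵀ C̃_{rs} z_s − γ‖z_s‖₁ over the closed unit ball B^{p_s}. -/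
open Finset Metric

/-- with `aᵢ = ∑_{r≠s} c̃_{rsi}ᵀ z_r`, `γ = ∑_{r≠s} Γ_{sr}` and
`S = ∑ k ([|a_k| - γ]₊)² > 0`, the vector `z_s*` with entries `sgn(aᵢ)[|aᵢ| - γ]₊/√S`
has unit norm and attains the supremum of the penalized multi-view objective over the
closed unit ball. -/
theorem stmt_8 (m : ℕ) (hm : 2 ≤ m) (p : Fin m → ℕ) (s : Fin m)
    (Ct : ∀ r : Fin m, Matrix (Fin (p r)) (Fin (p s)) ℝ)
    (z : ∀ r : Fin m, EuclideanSpace ℝ (Fin (p r)))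
    (Γ : Fin m → ℝ) (hΓ : ∀ r, 0 ≤ Γ r)
    (a : Fin (p s) → ℝ) (ha : ∀ i, a i = ∑ r ∈ univ.erase s, ∑ j, Ct r j i * z r j)
    (γ : ℝ) (hγ : γ = ∑ r ∈ univ.erase s, Γ r)
    (S : ℝ) (hS : S = ∑ k, (max (|a k| - γ) 0) ^ 2) (hSpos : 0 < S)
    (zsstar : EuclideanSpace ℝ (Fin (p s)))
    (hz : ∀ i, zsstar i = Real.sign (a i) * max (|a i| - γ) 0 / Real.sqrt S) :
    ‖zsstar‖ = 1 ∧
    ∀ zs : EuclideanSpace ℝ (Fin (p s)), ‖zs‖ ≤ 1 →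
      (∑ r ∈ univ.erase s, ∑ i, (∑ j, z r j * Ct r j i) * zs i) - γ * ∑ i, |zs i| ≤
        (∑ r ∈ univ.erase s, ∑ i, (∑ j, z r j * Ct r j i) * zsstar i) -
          γ * ∑ i, |zsstar i| := by
  have hγ0 : 0 ≤ γ := hγ ▸ Finset.sum_nonneg (fun r _ => hΓ r)
  have hobj : ∀ v : EuclideanSpace ℝ (Fin (p s)),
      (∑ r ∈ univ.erase s, ∑ i, (∑ j, z r j * Ct r j i) * v i) - γ * ∑ i, |v i|
        = ∑ i, (a i * v i - γ * |v i|) := by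
    intro v
    rw [Finset.sum_sub_distrib, Finset.mul_sum, Finset.sum_comm]
    congr 1
    refine Finset.sum_congr rfl fun i _ => ?_
    rw [ha i, Finset.sum_mul]
    refine Finset.sum_congr rfl fun r _ => ?_
    congr 1
    exact Finset.sum_congr rfl fun j _ => mul_comm _ _
  obtain ⟨q, hq, hq0⟩ : ∃ q, q = Real.sqrt S ∧ 0 < q := ⟨_, rfl, Real.sqrt_pos.2 hSpos⟩
  have hqq : q ^ 2 = S := by rw [hq]; exact Real.sq_sqrt hSpos.le
  rw [← hq] at hz
  have hsq : ∀ i, (zsstar i) ^ 2 = (max (|a i| - γ) 0) ^ 2 / S := by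
    intro i
    rw [hz i, div_pow, hqq, mul_pow]
    congr 1
    rcases lt_trichotomy (a i) 0 with h | h | h
    · rw [Real.sign_of_neg h]; ring
    · have : max (|a i| - γ) 0 = 0 := by rw [h]; simp [hγ0]
      rw [this]; ring
    · rw [Real.sign_of_pos h]; ring
  have hstar : ∀ i, a i * zsstar i - γ * |zsstar i| = (max (|a i| - γ) 0) ^ 2 / q := by
    intro i
    have hw : 0 ≤ max (|a i| - γ) 0 := le_max_right _ _
    have hw2 : (|a i| - γ) * max (|a i| - γ) 0 = (max (|a i| - γ) 0) ^ 2 := by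
      rcases le_total (|a i| - γ) 0 with h | h
      · rw [max_eq_right h]; ring
      · rw [max_eq_left h]; ring
    rw [hz i, abs_div, abs_mul, abs_of_pos hq0, abs_of_nonneg hw, ← hw2]
    rcases lt_trichotomy (a i) 0 with h | h | h
    · rw [Real.sign_of_neg h, abs_of_neg h]; simp; ring
    · have : max (|a i| - γ) 0 = 0 := by rw [h]; simp [hγ0]
      rw [this]; simp
    · rw [Real.sign_of_pos h, abs_of_pos h]; simp; ring
  have hval : ∑ i, (a i * zsstar i - γ * |zsstar i|) = q := by
    rw [Finset.sum_congr rfl fun i _ => hstar i, ← Finset.sum_div, ← hS, ← hqq]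
    field_simp
  refine ⟨?_, ?_⟩
  · have h : ‖zsstar‖ ^ 2 = 1 := by
      rw [EuclideanSpace.real_norm_sq_eq, Finset.sum_congr rfl fun i _ => hsq i,
        ← Finset.sum_div, ← hS, div_self hSpos.ne']
    nlinarith [norm_nonneg zsstar]
  · intro v hv
    rw [hobj, hobj, hval]
    have hv2 : ∑ i, (v i) ^ 2 ≤ 1 := by
      rw [← EuclideanSpace.real_norm_sq_eq]
      nlinarith [norm_nonneg v]
    have hle : ∀ i, a i * v i - γ * |v i| ≤
        ((max (|a i| - γ) 0) ^ 2 / q + q * (v i) ^ 2) / 2 := by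
      intro i
      have h1 : a i * v i ≤ |a i| * |v i| := by rw [← abs_mul]; exact le_abs_self _
      have h2 : (|a i| - γ) * |v i| ≤ max (|a i| - γ) 0 * |v i| :=
        mul_le_mul_of_nonneg_right (le_max_left _ _) (abs_nonneg _)
      have h3 : (max (|a i| - γ) 0 ^ 2 / q + q * (v i) ^ 2) / 2 - max (|a i| - γ) 0 * |v i|
          = (max (|a i| - γ) 0 - q * |v i|) ^ 2 / (2 * q) := by
        rw [← sq_abs (v i)]; field_simp; ring
      have h4 : 0 ≤ (max (|a i| - γ) 0 - q * |v i|) ^ 2 / (2 * q) := by positivity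
      linarith
    calc _ ≤ ∑ i, ((max (|a i| - γ) 0) ^ 2 / q + q * (v i) ^ 2) / 2 :=
          Finset.sum_le_sum fun i _ => hle i
      _ = (S / q + q * ∑ i, (v i) ^ 2) / 2 := by
          rw [← Finset.sum_div, Finset.sum_add_distrib, ← Finset.sum_div, ← hS, Finset.mul_sum]
      _ ≤ q := by
          have : S / q = q := by rw [← hqq]; field_simp
          rw [this]; nlinarith
end

section
/- Let C ∈ ℝ^{p₁×p₂} with columns c₁,…,c_{p₂}, let X₂ ∈ ℝ^{n×p₂} with columns x_{21},…,x_{2p₂} ∈ ℝⁿ, let y ∈ ℝⁿ, let z₁ ∈ ℝ^{p₁} be fixed, and let γ₂, ε₂ ≥ 0. Then the supremum over z₂ in the closed unit ball B^{p₂} of z₁ᵀ C z₂ + ε₂·yᵀ X₂ z₂ − γ₂‖z₂‖₁ equals sqrt( Σ_{i=1}^{p₂} ([ |cᵢᵀ z₁ + ε₂·x_{2i}ᵀ y| − γ₂ ]₊)² ). -/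
open Finset Metric

lemma aux_core (p : ℕ) (a : Fin p → ℝ) (g : ℝ) (hg : 0 ≤ g) :
    IsGreatest ((fun z : EuclideanSpace ℝ (Fin p) => ∑ i, (a i * z i - g * |z i|)) '' closedBall 0 1)
      (Real.sqrt (∑ i, (max (|a i| - g) 0) ^ 2)) := by
  set t : Fin p → ℝ := fun i => max (|a i| - g) 0 with ht
  have ht0 : ∀ i, 0 ≤ t i := fun i => le_max_right _ _
  have hts : (0:ℝ) ≤ ∑ i, t i ^ 2 := Finset.sum_nonneg fun i _ => sq_nonneg _
  change IsGreatest _ (Real.sqrt (∑ i, t i ^ 2))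
  set S := Real.sqrt (∑ i, t i ^ 2) with hS
  have hS0 : 0 ≤ S := Real.sqrt_nonneg _
  have hSS : S ^ 2 = ∑ i, t i ^ 2 := Real.sq_sqrt hts
  have key : ∀ i, ∃ s : ℝ, |s| ≤ 1 ∧ a i * (s * t i / S) - g * |s * t i / S| = t i ^ 2 / S := by
    intro i
    rcases le_or_gt (|a i| - g) 0 with h | h
    · refine ⟨0, by simp, ?_⟩
      have : t i = 0 := max_eq_right h
      simp [this]
    · have h1 : t i = |a i| - g := max_eq_left h.le
      have h2 : 0 ≤ t i / S := div_nonneg (ht0 i) hS0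
      rcases le_total 0 (a i) with h3 | h3
      · refine ⟨1, by simp, ?_⟩
        rw [one_mul, abs_of_nonneg h2]
        rw [abs_of_nonneg h3] at h1
        rw [show a i = t i + g by linarith]; ring
      · refine ⟨-1, by simp, ?_⟩
        rw [neg_one_mul, neg_div, abs_neg, abs_of_nonneg h2]
        rw [abs_of_nonpos h3] at h1
        rw [show a i = -(t i + g) by linarith]; ring
  choose s hs1 hs2 using key
  constructor
  · refine ⟨WithLp.toLp 2 (fun i => s i * t i / S), ?_, ?_⟩
    · rw [mem_closedBall_zero_iff, EuclideanSpace.norm_eq, Real.sqrt_le_one]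
      have : ∀ i, ‖s i * t i / S‖ ^ 2 ≤ t i ^ 2 / S ^ 2 := by
        intro i
        rw [Real.norm_eq_abs, sq_abs, div_pow, mul_pow]
        have : s i ^ 2 ≤ 1 := (sq_le_one_iff_abs_le_one _).2 (hs1 i)
        gcongr
        nlinarith [sq_nonneg (t i)]
      refine (Finset.sum_le_sum fun i _ => this i).trans ?_
      rw [← Finset.sum_div, ← hSS]
      exact div_self_le_one _
    · simp only [hs2]
      rw [← Finset.sum_div, ← hSS, sq, mul_self_div_self]
  · rintro _ ⟨z, hz, rfl⟩
    rw [mem_closedBall_zero_iff, EuclideanSpace.norm_eq] at hz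
    calc ∑ i, (a i * z i - g * |z i|) ≤ ∑ i, t i * ‖z i‖ := by
          refine Finset.sum_le_sum fun i _ => ?_
          have h1 : a i * z i ≤ |a i| * |z i| := by rw [← abs_mul]; exact le_abs_self _
          have h2 : |a i| - g ≤ t i := le_max_left _ _
          rw [Real.norm_eq_abs]
          nlinarith [abs_nonneg (z i)]
      _ ≤ S * Real.sqrt (∑ i, ‖z i‖ ^ 2) := Real.sum_mul_le_sqrt_mul_sqrt _ _ _
      _ ≤ S := mul_le_of_le_one_right hS0 hz

/-- directed case. For fixed `z₁`, `y`, and `γ₂, ε₂ ≥ 0`, the supremum over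
`z₂` in the closed unit ball of `z₁ᵀ C z₂ + ε₂ yᵀ X₂ z₂ - γ₂‖z₂‖₁` equals
`√(∑ i ([|cᵢᵀ z₁ + ε₂ x_{2i}ᵀ y| - γ₂]₊)²)`. -/
theorem stmt_10 (n p₁ p₂ : ℕ) (C : Matrix (Fin p₁) (Fin p₂) ℝ)
    (X₂ : Matrix (Fin n) (Fin p₂) ℝ) (y : EuclideanSpace ℝ (Fin n))
    (z₁ : EuclideanSpace ℝ (Fin p₁)) (γ₂ ε₂ : ℝ) (hγ₂ : 0 ≤ γ₂) (hε₂ : 0 ≤ ε₂) :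
    sSup ((fun z₂ : EuclideanSpace ℝ (Fin p₂) =>
        (∑ i, (∑ j, z₁ j * C j i) * z₂ i) + ε₂ * (∑ i, (∑ k, y k * X₂ k i) * z₂ i) -
          γ₂ * ∑ i, |z₂ i|) '' closedBall 0 1) =
      Real.sqrt (∑ i,
        (max (|(∑ j, C j i * z₁ j) + ε₂ * ∑ k, X₂ k i * y k| - γ₂) 0) ^ 2) := by
  have h := (aux_core p₂ (fun i => (∑ j, C j i * z₁ j) + ε₂ * ∑ k, X₂ k i * y k) γ₂ hγ₂).csSup_eq
  rw [← h]
  congr 2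
  funext z
  rw [Finset.mul_sum, Finset.mul_sum, ← Finset.sum_add_distrib, ← Finset.sum_sub_distrib]
  refine Finset.sum_congr rfl fun i _ => ?_
  simp only [mul_comm (z₁ _), mul_comm (y _)]
  ring
end

section
/- Let C ∈ ℝ^{p₁×p₂} with columns c₁,…,c_{p₂}, let X₂ ∈ ℝ^{n×p₂} with columns x_{21},…,x_{2p₂} ∈ ℝⁿ, let y ∈ ℝⁿ, z₁ ∈ ℝ^{p₁}, γ₂, ε₂ ≥ 0, and suppose S := Σ_{k=1}^{p₂} ([ |c_kᵀ z₁ + ε₂·x_{2k}ᵀ y| − γ₂ ]₊)² > 0. Then the vector z₂* with entries z₂ᵢ* = sgn(cᵢᵀ z₁ + ε₂·x_{2i}ᵀ y)·[ |cᵢᵀ z₁ + ε₂·x_{2i}ᵀ y| − γ₂ ]₊ / √S has ‖z₂*‖₂ = 1 and attains the supremum of z₂ ↦ z₁ᵀ C z₂ + ε₂·yᵀ X₂ z₂ − γ₂‖z₂‖₁ over the closed unit ball B^{p₂}, with optimal value √S. -/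
open Finset Metric

theorem aux_sq (a g : ℝ) (hg : 0 ≤ g) :
    |Real.sign a * max (|a| - g) 0| = max (|a| - g) 0 ∧
    a * (Real.sign a * max (|a| - g) 0) - g * max (|a| - g) 0 = (max (|a| - g) 0) ^ 2 := by
  have hm : 0 ≤ max (|a| - g) 0 := le_max_right _ _
  have hk : |a| * max (|a| - g) 0 - g * max (|a| - g) 0 = (max (|a| - g) 0) ^ 2 := by
    rcases le_total (|a| - g) 0 with h | h
    · rw [max_eq_right h]; ring
    · rw [max_eq_left h]; ring
  rcases lt_trichotomy a 0 with h | h | h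
  · rw [Real.sign_of_neg h, abs_mul, abs_of_nonneg hm]
    refine ⟨by norm_num, ?_⟩
    rw [← hk]
    nth_rewrite 3 [abs_of_neg h]
    ring
  · have : max (|a| - g) 0 = 0 := max_eq_right (by rw [h]; simpa using hg)
    rw [this]; simp
  · rw [Real.sign_of_pos h, abs_mul, abs_of_nonneg hm]
    refine ⟨by norm_num, ?_⟩
    rw [← hk]
    nth_rewrite 3 [abs_of_pos h]
    ring

theorem aux_main (p : ℕ) (a : Fin p → ℝ) (g S : ℝ) (hg : 0 ≤ g)
    (hS : S = ∑ k, (max (|a k| - g) 0) ^ 2) (hSpos : 0 < S)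
    (w : EuclideanSpace ℝ (Fin p))
    (hw : ∀ i, w i = Real.sign (a i) * max (|a i| - g) 0 / Real.sqrt S) :
    ‖w‖ = 1 ∧ ∑ i, (a i * w i - g * |w i|) = Real.sqrt S ∧
    ∀ z : EuclideanSpace ℝ (Fin p), ‖z‖ ≤ 1 →
      ∑ i, (a i * z i - g * |z i|) ≤ Real.sqrt S := by
  have hr : 0 < Real.sqrt S := Real.sqrt_pos.2 hSpos
  have hrr : Real.sqrt S ^ 2 = S := Real.sq_sqrt hSpos.le
  have habs : ∀ i, |w i| = max (|a i| - g) 0 / Real.sqrt S := fun i => by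
    rw [hw, abs_div, (aux_sq _ _ hg).1, abs_of_pos hr]
  refine ⟨?_, ?_, ?_⟩
  · rw [EuclideanSpace.norm_eq]
    simp only [Real.norm_eq_abs, habs, div_pow, hrr]
    rw [← Finset.sum_div, ← hS, div_self hSpos.ne', Real.sqrt_one]
  · have : ∀ i, a i * w i - g * |w i| = (max (|a i| - g) 0) ^ 2 / Real.sqrt S := fun i => by
      rw [habs, hw, ← (aux_sq (a i) g hg).2]; ring
    simp only [this]
    rw [← Finset.sum_div, ← hS, Real.div_sqrt]
  · intro z hz
    have h1 : ∑ i, (a i * z i - g * |z i|) ≤ ∑ i, max (|a i| - g) 0 * |z i| := by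
      apply Finset.sum_le_sum
      intro i _
      have h2 : a i * z i ≤ |a i| * |z i| := by rw [← abs_mul]; exact le_abs_self _
      have h3 := mul_le_mul_of_nonneg_right (le_max_left (|a i| - g) 0) (abs_nonneg (z i))
      linarith
    have h4 := Real.sum_mul_le_sqrt_mul_sqrt Finset.univ (fun i => max (|a i| - g) 0)
      (fun i => |z i|)
    rw [EuclideanSpace.norm_eq] at hz
    simp only [Real.norm_eq_abs] at hz
    rw [← hS] at h4
    have h5 := mul_le_mul_of_nonneg_left hz hr.le
    linarith

/-- with `S = ∑ k ([|c_kᵀ z₁ + ε₂ x_{2k}ᵀ y| - γ₂]₊)² > 0`, the vector `z₂*`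
with entries `sgn(cᵢᵀ z₁ + ε₂ x_{2i}ᵀ y)[|cᵢᵀ z₁ + ε₂ x_{2i}ᵀ y| - γ₂]₊/√S` has unit norm
and attains the supremum of the directed penalized objective over the closed unit ball,
with value `√S`. -/
theorem stmt_11 (n p₁ p₂ : ℕ) (C : Matrix (Fin p₁) (Fin p₂) ℝ)
    (X₂ : Matrix (Fin n) (Fin p₂) ℝ) (y : EuclideanSpace ℝ (Fin n))
    (z₁ : EuclideanSpace ℝ (Fin p₁)) (γ₂ ε₂ : ℝ) (hγ₂ : 0 ≤ γ₂) (hε₂ : 0 ≤ ε₂)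
    (S : ℝ)
    (hS : S = ∑ k, (max (|(∑ j, C j k * z₁ j) + ε₂ * ∑ l, X₂ l k * y l| - γ₂) 0) ^ 2)
    (hSpos : 0 < S)
    (z₂star : EuclideanSpace ℝ (Fin p₂))
    (hz : ∀ i, z₂star i =
      Real.sign ((∑ j, C j i * z₁ j) + ε₂ * ∑ k, X₂ k i * y k) *
        max (|(∑ j, C j i * z₁ j) + ε₂ * ∑ k, X₂ k i * y k| - γ₂) 0 / Real.sqrt S) :
    ‖z₂star‖ = 1 ∧
    ((∑ i, (∑ j, z₁ j * C j i) * z₂star i) + ε₂ * (∑ i, (∑ k, y k * X₂ k i) * z₂star i) -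
        γ₂ * ∑ i, |z₂star i| = Real.sqrt S) ∧
    ∀ z₂ : EuclideanSpace ℝ (Fin p₂), ‖z₂‖ ≤ 1 →
      (∑ i, (∑ j, z₁ j * C j i) * z₂ i) + ε₂ * (∑ i, (∑ k, y k * X₂ k i) * z₂ i) -
        γ₂ * ∑ i, |z₂ i| ≤ Real.sqrt S := by
  have key : ∀ z : EuclideanSpace ℝ (Fin p₂),
      (∑ i, (∑ j, z₁ j * C j i) * z i) + ε₂ * (∑ i, (∑ k, y k * X₂ k i) * z i) -
        γ₂ * ∑ i, |z i| =
      ∑ i, (((∑ j, C j i * z₁ j) + ε₂ * ∑ k, X₂ k i * y k) * z i - γ₂ * |z i|) := by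
    intro z
    rw [Finset.mul_sum, Finset.mul_sum, ← Finset.sum_add_distrib, ← Finset.sum_sub_distrib]
    refine Finset.sum_congr rfl fun i _ => ?_
    simp only [mul_comm (z₁ _), mul_comm (y _)]
    ring
  simp only [key]
  exact aux_main p₂ (fun i => (∑ j, C j i * z₁ j) + ε₂ * ∑ k, X₂ k i * y k) γ₂ S hγ₂ hS hSpos
    z₂star hz
end

section
/- Let b ∈ ℝ^p and let γ₁,…,γ_p ≥ 0 be coordinate-wise thresholds. Then the supremum over z in the closed unit ball B^p of ⟨b, z⟩ − Σ_{i=1}^p γᵢ|zᵢ| equals sqrt( Σ_{i=1}^p ([|bᵢ| − γᵢ]₊)² ), and when this value is positive it is attained by the vector with entries sgn(bᵢ)·[|bᵢ| − γᵢ]₊ / sqrt(Σ_k ([|b_k| − γ_k]₊)²), which lies on the unit sphere. -/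
open Finset Metric

theorem aux14 (b g S : ℝ) (hg : 0 ≤ g) (hS : 0 < S) :
    (Real.sign b * max (|b| - g) 0 / S) ^ 2 = (max (|b| - g) 0) ^ 2 / S ^ 2 ∧
    b * (Real.sign b * max (|b| - g) 0 / S) - g * |Real.sign b * max (|b| - g) 0 / S| =
      (max (|b| - g) 0) ^ 2 / S := by
  have hm : (|b| - g) * max (|b| - g) 0 = (max (|b| - g) 0) ^ 2 := by
    rcases le_total (|b| - g) 0 with h | h
    · simp [max_eq_right h]
    · rw [max_eq_left h]; ring
  have hm0 : 0 ≤ max (|b| - g) 0 := le_max_right _ _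
  have hz : b = 0 → max (|b| - g) 0 = 0 := by
    rintro rfl
    simp [hg]
  generalize max (|b| - g) 0 = m at *
  rcases lt_trichotomy b 0 with h | h | h
  · rw [Real.sign_of_neg h, abs_div, abs_mul, abs_of_pos hS, abs_of_nonneg hm0]
    rw [abs_of_neg h] at hm
    refine ⟨by ring, ?_⟩
    rw [← hm]
    norm_num
    ring
  · simp [hz h]
  · rw [Real.sign_of_pos h, abs_div, abs_mul, abs_of_pos hS, abs_of_nonneg hm0]
    rw [abs_of_pos h] at hm
    refine ⟨by ring, ?_⟩
    rw [← hm]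
    norm_num
    ring

/-- coordinate-wise thresholds. The supremum over the closed unit ball of
`⟨b, z⟩ - ∑ i γᵢ|zᵢ|` equals `√(∑ i ([|bᵢ| - γᵢ]₊)²)`, and when this value is positive it
is attained by the unit vector with entries `sgn(bᵢ)[|bᵢ| - γᵢ]₊ / √(∑ k ([|b_k| - γ_k]₊)²)`. -/
theorem stmt_14 (p : ℕ) (b : EuclideanSpace ℝ (Fin p)) (γ : Fin p → ℝ)
    (hγ : ∀ i, 0 ≤ γ i) :
    sSup ((fun z : EuclideanSpace ℝ (Fin p) =>
        (∑ i, b i * z i) - ∑ i, γ i * |z i|) '' closedBall 0 1) =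
      Real.sqrt (∑ i, (max (|b i| - γ i) 0) ^ 2) ∧
    ∀ zstar : EuclideanSpace ℝ (Fin p),
      (∀ i, zstar i = Real.sign (b i) * max (|b i| - γ i) 0 /
          Real.sqrt (∑ k, (max (|b k| - γ k) 0) ^ 2)) →
      0 < Real.sqrt (∑ k, (max (|b k| - γ k) 0) ^ 2) →
      ‖zstar‖ = 1 ∧
      (∑ i, b i * zstar i) - ∑ i, γ i * |zstar i| =
        Real.sqrt (∑ k, (max (|b k| - γ k) 0) ^ 2) := by
  have hnn : 0 ≤ ∑ k, (max (|b k| - γ k) 0) ^ 2 := Finset.sum_nonneg fun _ _ => sq_nonneg _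
  have h2 : ∀ zstar : EuclideanSpace ℝ (Fin p),
      (∀ i, zstar i = Real.sign (b i) * max (|b i| - γ i) 0 /
          Real.sqrt (∑ k, (max (|b k| - γ k) 0) ^ 2)) →
      0 < Real.sqrt (∑ k, (max (|b k| - γ k) 0) ^ 2) →
      ‖zstar‖ = 1 ∧
      (∑ i, b i * zstar i) - ∑ i, γ i * |zstar i| =
        Real.sqrt (∑ k, (max (|b k| - γ k) 0) ^ 2) := by
    intro z hz hS
    have hsq := Real.sq_sqrt hnn
    generalize Real.sqrt (∑ k, (max (|b k| - γ k) 0) ^ 2) = S at *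
    constructor
    · rw [EuclideanSpace.norm_eq, Real.sqrt_eq_one]
      have : ∀ i, ‖z i‖ ^ 2 = (max (|b i| - γ i) 0) ^ 2 / S ^ 2 := fun i => by
        rw [Real.norm_eq_abs, sq_abs, hz i]
        exact (aux14 _ _ S (hγ i) hS).1
      simp_rw [this]
      rw [← Finset.sum_div, ← hsq]
      field_simp
    · rw [← Finset.sum_sub_distrib]
      have : ∀ i, b i * z i - γ i * |z i| = (max (|b i| - γ i) 0) ^ 2 / S := fun i => by
        rw [hz i]
        exact (aux14 _ _ S (hγ i) hS).2
      simp_rw [this]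
      rw [← Finset.sum_div, ← hsq]
      field_simp
  refine ⟨?_, h2⟩
  apply IsGreatest.csSup_eq
  constructor
  · rcases (Real.sqrt_nonneg (∑ k, (max (|b k| - γ k) 0) ^ 2)).lt_or_eq with hS | hS
    · obtain ⟨h1, h3⟩ := h2 (WithLp.toLp 2 fun i => Real.sign (b i) * max (|b i| - γ i) 0 /
          Real.sqrt (∑ k, (max (|b k| - γ k) 0) ^ 2)) (fun i => rfl) hS
      exact ⟨_, by rw [mem_closedBall_zero_iff]; exact h1.le, h3⟩
    · rw [← hS]
      exact ⟨0, by simp, by simp⟩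
  · rintro _ ⟨z, hz, rfl⟩
    rw [mem_closedBall_zero_iff, EuclideanSpace.norm_eq] at hz
    have hcs := Real.sum_mul_le_sqrt_mul_sqrt Finset.univ
      (fun i => max (|b i| - γ i) 0) (fun i => ‖z i‖)
    have h1 : (∑ i, b i * z i) - ∑ i, γ i * |z i| ≤ ∑ i, max (|b i| - γ i) 0 * ‖z i‖ := by
      rw [← Finset.sum_sub_distrib]
      refine Finset.sum_le_sum fun i _ => ?_
      rw [Real.norm_eq_abs]
      have e1 : b i * z i ≤ |b i| * |z i| := by rw [← abs_mul]; exact le_abs_self _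
      have e2 := mul_le_mul_of_nonneg_right (le_max_left (|b i| - γ i) 0) (abs_nonneg (z i))
      linarith
    exact h1.trans (hcs.trans (mul_le_of_le_one_right (Real.sqrt_nonneg _) hz))
end
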